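/- (Theorem: convergence bound for bounded-precision influences) Let k ∈ ℕ and suppose the influence b and all edge weights w_e have bounded precision k, i.e., 10^k·b and 10^k·w_e are positive integers for all e ∈ E. Then every sequence of asynchronous improvement steps of the opinion game on a graph with n vertices has length at most 10^k·(4bn + 4·w_max·n²)/δ², where w_max = max_{e∈E} w_e; hence the opinion dynamics with asynchronous updates converges to a Nash equilibrium within that many steps. -/

import Mathlib

open Finset

/-- The recommendation function with threshold λ = 1/2. -/
noncomputable def sRec (x : ℝ) : ℝ :=
  if x < -(1/2 : ℝ) then -1 else if (1/2 : ℝ) < x then 1 else 0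

/-- Membership in the opinion grid Θ = {-1, -1+δ, …, 1-δ, 1}. -/
def inGrid (δ x : ℝ) : Prop := |x| ≤ 1 ∧ ∃ k : ℤ, x = k * δ

/-- Cost to agent `i` of holding opinion `y` when the current profile is `x`.
Non-edges are modelled by weight `0`. -/
noncomputable def cost {n : ℕ} (b : ℝ) (w : Fin n → Fin n → ℝ) (i : Fin n)
    (y : ℝ) (x : Fin n → ℝ) : ℝ :=
  b * (y - sRec (x i)) ^ 2 + ∑ j, w i j * (y - x j) ^ 2

/-- An asynchronous improvement step: a single agent `i` switches to an opinion
`y ∈ Θ` that strictly decreases her cost. -/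
def ImprStep {n : ℕ} (δ b : ℝ) (w : Fin n → Fin n → ℝ) (x x' : Fin n → ℝ) : Prop :=
  ∃ i y, inGrid δ y ∧ cost b w i y x < cost b w i (x i) x ∧ x' = Function.update x i y

/-- A profile is a Nash equilibrium (stable) if every agent's opinion minimizes
her cost over Θ. -/
def NashEq {n : ℕ} (δ b : ℝ) (w : Fin n → Fin n → ℝ) (x : Fin n → ℝ) : Prop :=
  ∀ i y, inGrid δ y → cost b w i (x i) x ≤ cost b w i y x

lemma sRec_int (x : ℝ) : ∃ z : ℤ, sRec x = z := by
  unfold sRec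
  split_ifs
  · exact ⟨-1, by simp⟩
  · exact ⟨1, by simp⟩
  · exact ⟨0, by simp⟩

lemma sRec_best (x y : ℝ) : (y - sRec y) ^ 2 ≤ (y - sRec x) ^ 2 := by
  unfold sRec
  split_ifs <;> nlinarith

lemma sRec_le (y : ℝ) (hy : |y| ≤ 1) : (y - sRec y) ^ 2 ≤ 1 := by
  have h := abs_le.mp hy
  unfold sRec
  split_ifs <;> nlinarith

noncomputable def pot {n : ℕ} (b : ℝ) (w : Fin n → Fin n → ℝ) (x : Fin n → ℝ) : ℝ :=
  ∑ i, b * (x i - sRec (x i)) ^ 2 + (1 / 2) * ∑ i, ∑ j, w i j * (x i - x j) ^ 2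

lemma quad_update {n : ℕ} (w : Fin n → Fin n → ℝ)
    (hsym : ∀ i j, w i j = w j i) (hdiag : ∀ i, w i i = 0) (x : Fin n → ℝ) (i : Fin n) (y : ℝ) :
    ∑ p, ∑ q, w p q * (Function.update x i y p - Function.update x i y q) ^ 2
      = ∑ p, ∑ q, w p q * (x p - x q) ^ 2
        + 2 * (∑ j, w i j * (y - x j) ^ 2 - ∑ j, w i j * (x i - x j) ^ 2) := by
  have key : ∀ p q, w p q * (Function.update x i y p - Function.update x i y q) ^ 2
      = w p q * (x p - x q) ^ 2
        + ((if p = i then w i q * (y - x q) ^ 2 - w i q * (x i - x q) ^ 2 else 0)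
        + (if q = i then w i p * (y - x p) ^ 2 - w i p * (x i - x p) ^ 2 else 0)) := by
    intro p q
    by_cases hp : p = i <;> by_cases hq : q = i
    · subst hp; subst hq; simp [hdiag]
    · subst hp; simp [hq]
    · subst hq; simp [hp]; rw [hsym p q]; ring
    · simp [hp, hq]
  simp_rw [key, Finset.sum_add_distrib]
  rw [Finset.sum_comm (f := fun p q => if p = i then w i q * (y - x q) ^ 2 - w i q * (x i - x q) ^ 2 else 0)]
  simp only [Finset.sum_ite_eq', Finset.mem_univ, if_true, Finset.sum_sub_distrib]
  ring

lemma pot_update {n : ℕ} (b : ℝ) (hb : 0 < b) (w : Fin n → Fin n → ℝ)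
    (hsym : ∀ i j, w i j = w j i) (hdiag : ∀ i, w i i = 0) (x : Fin n → ℝ) (i : Fin n) (y : ℝ) :
    pot b w (Function.update x i y) + cost b w i (x i) x ≤ pot b w x + cost b w i y x := by
  unfold pot cost
  rw [quad_update w hsym hdiag]
  have h1 : ∑ p, b * (Function.update x i y p - sRec (Function.update x i y p)) ^ 2
      = ∑ p, b * (x p - sRec (x p)) ^ 2
        + (b * (y - sRec y) ^ 2 - b * (x i - sRec (x i)) ^ 2) := by
    have key : ∀ p, b * (Function.update x i y p - sRec (Function.update x i y p)) ^ 2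
      = b * (x p - sRec (x p)) ^ 2
        + (if p = i then b * (y - sRec y) ^ 2 - b * (x i - sRec (x i)) ^ 2 else 0) := by
      intro p
      by_cases hp : p = i
      · subst hp; simp
      · simp [hp]
    simp_rw [key, Finset.sum_add_distrib]
    simp
  rw [h1]
  have := mul_le_mul_of_nonneg_left (sRec_best (x i) y) hb.le
  linarith

lemma pot_nonneg {n : ℕ} (b : ℝ) (hb : 0 < b) (w : Fin n → Fin n → ℝ)
    (hw : ∀ i j, 0 ≤ w i j) (x : Fin n → ℝ) : 0 ≤ pot b w x := by
  unfold pot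
  have h1 : 0 ≤ ∑ i, b * (x i - sRec (x i)) ^ 2 := Finset.sum_nonneg fun i _ => by positivity
  have h2 : 0 ≤ ∑ i, ∑ j, w i j * (x i - x j) ^ 2 :=
    Finset.sum_nonneg fun i _ => Finset.sum_nonneg fun j _ => mul_nonneg (hw i j) (sq_nonneg _)
  linarith

lemma pot_le {n : ℕ} (b : ℝ) (hb : 0 < b) (w : Fin n → Fin n → ℝ)
    (hw : ∀ i j, 0 ≤ w i j) (wmax : ℝ) (hub : ∀ i j, w i j ≤ wmax) (hmax : 0 ≤ wmax)
    (x : Fin n → ℝ) (hx : ∀ i, |x i| ≤ 1) :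
    pot b w x ≤ 4 * b * n + 4 * wmax * n ^ 2 := by
  unfold pot
  have h1 : ∑ i, b * (x i - sRec (x i)) ^ 2 ≤ ∑ i : Fin n, b :=
    Finset.sum_le_sum fun i _ => by nlinarith [sRec_le (x i) (hx i)]
  have h2 : ∑ i, ∑ j, w i j * (x i - x j) ^ 2 ≤ ∑ i : Fin n, ∑ j : Fin n, wmax * 4 := by
    refine Finset.sum_le_sum fun i _ => Finset.sum_le_sum fun j _ => ?_
    have hi := abs_le.mp (hx i)
    have hj := abs_le.mp (hx j)
    have : (x i - x j) ^ 2 ≤ 4 := by nlinarith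
    exact mul_le_mul (hub i j) this (sq_nonneg _) hmax
  simp only [Finset.sum_const, Finset.card_univ, Fintype.card_fin, nsmul_eq_mul] at h1 h2
  have h3 : 0 ≤ (n : ℝ) * b := by positivity
  have h4 : 0 ≤ wmax * (n : ℝ) ^ 2 := by positivity
  nlinarith

lemma cost_int {n : ℕ} (m : ℕ) (hm : 2 ≤ m) (δ : ℝ) (hδ : δ = 1 / m)
    (b : ℝ) (w : Fin n → Fin n → ℝ) (k : ℕ)
    (hbInt : ∃ B : ℕ, 0 < B ∧ (B : ℝ) = 10 ^ k * b)
    (hwInt : ∀ i j, ∃ W : ℕ, (W : ℝ) = 10 ^ k * w i j)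
    (x : Fin n → ℝ) (hx : ∀ i, inGrid δ (x i)) (i : Fin n) (y : ℝ) (hy : inGrid δ y) :
    ∃ z : ℤ, 10 ^ k * (m : ℝ) ^ 2 * cost b w i y x = z := by
  have hm0 : (m : ℝ) ≠ 0 := by positivity
  have hgr : ∀ u, inGrid δ u → ∃ z : ℤ, (m : ℝ) * u = z := by
    rintro u ⟨-, c, rfl⟩
    exact ⟨c, by rw [hδ]; field_simp⟩
  obtain ⟨B, -, hB⟩ := hbInt
  choose W hW using hwInt
  choose X hX using fun j => hgr (x j) (hx j)
  obtain ⟨Y, hY⟩ := hgr y hy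
  obtain ⟨S, hS⟩ := sRec_int (x i)
  refine ⟨B * (Y - m * S) ^ 2 + ∑ j, W i j * (Y - X j) ^ 2, ?_⟩
  unfold cost
  push_cast
  rw [mul_add, Finset.mul_sum, hS, hB, ← hY]
  congr 1
  · ring
  · refine Finset.sum_congr rfl fun j _ => ?_
    rw [hW, ← hX]
    ring

lemma step_pot {n : ℕ} (m : ℕ) (hm : 2 ≤ m) (δ : ℝ) (hδ : δ = 1 / m)
    (b : ℝ) (hb : 0 < b) (w : Fin n → Fin n → ℝ)
    (hsym : ∀ i j, w i j = w j i) (hdiag : ∀ i, w i i = 0) (k : ℕ)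
    (hbInt : ∃ B : ℕ, 0 < B ∧ (B : ℝ) = 10 ^ k * b)
    (hwInt : ∀ i j, ∃ W : ℕ, (W : ℝ) = 10 ^ k * w i j)
    (x x' : Fin n → ℝ) (hx : ∀ i, inGrid δ (x i)) (h : ImprStep δ b w x x') :
    (∀ i, inGrid δ (x' i)) ∧
      10 ^ k * (m : ℝ) ^ 2 * pot b w x' + 1 ≤ 10 ^ k * (m : ℝ) ^ 2 * pot b w x := by
  obtain ⟨i, y, hy, hlt, rfl⟩ := h
  constructor
  · intro j
    by_cases hj : j = i
    · subst hj; simpa using hy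
    · simpa [hj] using hx j
  · obtain ⟨z1, h1⟩ := cost_int m hm δ hδ b w k hbInt hwInt x hx i y hy
    obtain ⟨z2, h2⟩ := cost_int m hm δ hδ b w k hbInt hwInt x hx i (x i) (hx i)
    have hC : (0 : ℝ) < 10 ^ k * (m : ℝ) ^ 2 := by positivity
    have h3 := mul_lt_mul_of_pos_left hlt hC
    rw [h1, h2] at h3
    have h4 : z1 + 1 ≤ z2 := by exact_mod_cast h3
    have h5 : (z1 : ℝ) + 1 ≤ z2 := by exact_mod_cast h4
    have h6 := mul_le_mul_of_nonneg_left (pot_update b hb w hsym hdiag x i y) hC.le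
    rw [mul_add, mul_add, h1, h2] at h6
    linarith

/-- If the influence b and all edge weights have bounded precision k (i.e. 10^k·b
and 10^k·w_e are positive integers), every sequence of asynchronous improvement
steps has length at most 10^k·(4bn + 4·w_max·n²)/δ², and from any initial profile
the asynchronous dynamics reaches a Nash equilibrium within that many steps. -/
theorem convergence_bound_bounded_precision
    {n : ℕ} (hn : 2 ≤ n) (m : ℕ) (hm : 2 ≤ m) (δ : ℝ) (hδ : δ = 1 / m)
    (b : ℝ) (hb : 0 < b) (w : Fin n → Fin n → ℝ)
    (hsym : ∀ i j, w i j = w j i) (hdiag : ∀ i, w i i = 0)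
    (hw : ∀ i j, 0 ≤ w i j)
    (k : ℕ)
    (hbInt : ∃ B : ℕ, 0 < B ∧ (B : ℝ) = 10 ^ k * b)
    (hwInt : ∀ i j, ∃ W : ℕ, (W : ℝ) = 10 ^ k * w i j)
    (wmax : ℝ) (hub : ∀ i j, w i j ≤ wmax) (hatt : ∃ i j, w i j = wmax) :
    (∀ (T : ℕ) (seq : ℕ → (Fin n → ℝ)), (∀ i, inGrid δ (seq 0 i)) →
      (∀ t, t < T → ImprStep δ b w (seq t) (seq (t + 1))) →
      (T : ℝ) ≤ 10 ^ k * (4 * b * n + 4 * wmax * n ^ 2) / δ ^ 2) ∧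
    (∀ x0 : Fin n → ℝ, (∀ i, inGrid δ (x0 i)) →
      ∃ (T : ℕ) (seq : ℕ → (Fin n → ℝ)),
        (T : ℝ) ≤ 10 ^ k * (4 * b * n + 4 * wmax * n ^ 2) / δ ^ 2 ∧ seq 0 = x0 ∧
        (∀ t, t < T → ImprStep δ b w (seq t) (seq (t + 1))) ∧
        NashEq δ b w (seq T)) := by
  have hmax : 0 ≤ wmax := by
    obtain ⟨i, j, h⟩ := hatt
    exact h ▸ hw i j
  have part1 : ∀ (T : ℕ) (seq : ℕ → (Fin n → ℝ)), (∀ i, inGrid δ (seq 0 i)) →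
      (∀ t, t < T → ImprStep δ b w (seq t) (seq (t + 1))) →
      (T : ℝ) ≤ 10 ^ k * (4 * b * n + 4 * wmax * n ^ 2) / δ ^ 2 := by
    intro T seq h0 hstep
    have key : ∀ t, t ≤ T → (∀ i, inGrid δ (seq t i)) ∧
        10 ^ k * (m : ℝ) ^ 2 * pot b w (seq t) + t ≤ 10 ^ k * (m : ℝ) ^ 2 * pot b w (seq 0) := by
      intro t
      induction t with
      | zero => intro _; exact ⟨h0, by simp⟩
      | succ t ih =>
        intro ht
        obtain ⟨hg, hp⟩ := ih (by omega)
        obtain ⟨hg', hp'⟩ := step_pot m hm δ hδ b hb w hsym hdiag k hbInt hwInt _ _ hg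
          (hstep t (by omega))
        refine ⟨hg', ?_⟩
        push_cast
        linarith
    have hC : (0 : ℝ) < 10 ^ k * (m : ℝ) ^ 2 := by positivity
    have h1 := (key T le_rfl).2
    have h2 := mul_nonneg hC.le (pot_nonneg b hb w hw (seq T))
    have h3 := mul_le_mul_of_nonneg_left
      (pot_le b hb w hw wmax hub hmax (seq 0) (fun i => (h0 i).1)) hC.le
    have h4 : 10 ^ k * (4 * b * n + 4 * wmax * n ^ 2) / δ ^ 2
        = 10 ^ k * (m : ℝ) ^ 2 * (4 * b * n + 4 * wmax * n ^ 2) := by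
      have hm0 : (m : ℝ) ≠ 0 := by positivity
      rw [hδ]
      field_simp
    rw [h4]
    linarith
  refine ⟨part1, ?_⟩
  intro x0 hx0
  by_contra hcon
  have ext : ∀ T : ℕ, ∃ seq : ℕ → (Fin n → ℝ), seq 0 = x0 ∧
      (∀ t, t < T → ImprStep δ b w (seq t) (seq (t + 1))) := by
    intro T
    induction T with
    | zero => exact ⟨fun _ => x0, rfl, fun t ht => by omega⟩
    | succ T ih =>
      obtain ⟨seq, hs0, hs⟩ := ih
      have hT := part1 T seq (by rw [hs0]; exact hx0) hs
      have hN : ¬ NashEq δ b w (seq T) := fun hN => hcon ⟨T, seq, hT, hs0, hs, hN⟩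
      unfold NashEq at hN
      push Not at hN
      obtain ⟨i, y, hy, hlt⟩ := hN
      refine ⟨fun t => if t ≤ T then seq t else Function.update (seq T) i y, by simpa using hs0, ?_⟩
      intro t ht
      by_cases htT : t = T
      · subst htT
        have hst : ImprStep δ b w (seq t) (Function.update (seq t) i y) := ⟨i, y, hy, hlt, rfl⟩
        simpa using hst
      · have h1 : t ≤ T := by omega
        have h2 : t + 1 ≤ T := by omega
        simp only [h1, h2, if_true]
        exact hs t (by omega)
  obtain ⟨T, hT⟩ := exists_nat_gt (10 ^ k * (4 * b * n + 4 * wmax * n ^ 2) / δ ^ 2)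
  obtain ⟨seq, hs0, hs⟩ := ext T
  exact absurd (part1 T seq (by rw [hs0]; exact hx0) hs) (not_le.mpr hT)
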